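/- There exists an integer n0 such that for every integer k with 2k − 1 ≥ n0, no finite simple graph on n = 2k − 1 vertices combinatorially realizes a ((k, 2k−1)) threshold scheme. (This is the combinatorial content of the statement that there exists no qQSS protocol with the secret encoded on all qubits once the number of players is large enough.) -/

import Mathlib

open Finset

/-- The odd neighborhood of a set `D` of vertices: the set of vertices having an odd
number of neighbors in `D`. -/
def oddNbhd {V : Type*} (G : SimpleGraph V) [Fintype V] [DecidableEq V]
    [DecidableRel G.Adj] (D : Finset V) : Finset V :=
  Finset.univ.filter fun v => Odd ((G.neighborFinset v) ∩ D).card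

/-- `B` is accessing: some `D ⊆ B` of odd cardinality has `Odd(D) ⊆ B`. -/
def accessing {V : Type*} (G : SimpleGraph V) [Fintype V] [DecidableEq V]
    [DecidableRel G.Adj] (B : Finset V) : Prop :=
  ∃ D ⊆ B, Odd D.card ∧ oddNbhd G D ⊆ B

/-- `B` is strongly accessing: it is accessing and moreover some `C ⊆ B` has
`V \ B ⊆ Odd(C)`. -/
def stronglyAccessing {V : Type*} (G : SimpleGraph V) [Fintype V] [DecidableEq V]
    [DecidableRel G.Adj] (B : Finset V) : Prop :=
  accessing G B ∧ ∃ C ⊆ B, Bᶜ ⊆ oddNbhd G C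

/-- `G` (on `n = |V|` vertices) combinatorially realizes a `((k,n))` threshold scheme:
every set of `k` vertices is strongly accessing and no set of `n − k` vertices is
accessing. -/
def realizesThreshold {V : Type*} (G : SimpleGraph V) [Fintype V] [DecidableEq V]
    [DecidableRel G.Adj] (k : ℕ) : Prop :=
  (∀ B : Finset V, B.card = k → stronglyAccessing G B) ∧
  (∀ B : Finset V, B.card = Fintype.card V - k → ¬ accessing G B)

section helpers

variable {V : Type} [Fintype V] [DecidableEq V]

/-- Vectors supported in `B` whose image under `A` is supported in `B`. -/
def KK (A : Matrix V V (ZMod 2)) (B : Finset V) : Submodule (ZMod 2) (V → ZMod 2) where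
  carrier := {x | ∀ v, v ∉ B → x v = 0 ∧ (A.mulVec x) v = 0}
  add_mem' := by
    intro x y hx hy v hv
    have h1 := hx v hv
    have h2 := hy v hv
    rw [Matrix.mulVec_add]
    simp [h1.1, h1.2, h2.1, h2.2]
  zero_mem' := by
    intro v hv
    simp
  smul_mem' := by
    intro c x hx v hv
    have h1 := hx v hv
    rw [Matrix.mulVec_smul]
    simp [h1.1, h1.2]

theorem mem_KK (A : Matrix V V (ZMod 2)) (B : Finset V) (x : V → ZMod 2) :
    x ∈ KK A B ↔ ∀ v, v ∉ B → x v = 0 ∧ (A.mulVec x) v = 0 := Iff.rfl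

theorem KK_mono (A : Matrix V V (ZMod 2)) {B C : Finset V} (h : B ⊆ C) : KK A B ≤ KK A C := by
  intro x hx v hv
  exact hx v (fun hb => hv (h hb))

theorem mulVec_restrict (A : Matrix V V (ZMod 2)) (B : Finset V) (x : V → ZMod 2)
    (hx : ∀ v, v ∉ B → x v = 0) (v : V) :
    (A.mulVec x) v = ∑ w : B, A v w * x w := by
  rw [Finset.sum_coe_sort B (fun w => A v w * x w)]
  unfold Matrix.mulVec dotProduct
  symm
  apply Finset.sum_subset (Finset.subset_univ B)
  intro w _ hw
  rw [hx w hw, mul_zero]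

/-- Identification with the kernel of a submatrix. -/
def kkEquiv (A : Matrix V V (ZMod 2)) (B C : Finset V) (h : ∀ v, v ∈ C ↔ v ∉ B) :
    KK A B ≃ₗ[ZMod 2]
      LinearMap.ker (A.submatrix (fun i : C => (i : V)) (fun j : B => (j : V))).mulVecLin where
  toFun x := ⟨fun j => x.1 j, by
    rw [LinearMap.mem_ker]
    ext i
    have h1 := x.2 i.1 ((h i.1).1 i.2)
    rw [mulVec_restrict A B x.1 (fun v hv => (x.2 v hv).1)] at h1
    simpa [Matrix.mulVec, dotProduct] using h1.2⟩
  map_add' x y := rfl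
  map_smul' c x := rfl
  invFun y := ⟨fun v => if hv : v ∈ B then y.1 ⟨v, hv⟩ else 0, by
    intro v hv
    refine ⟨by simp [hv], ?_⟩
    rw [mulVec_restrict A B _ (fun v hv => by simp [hv])]
    have h1 := congrFun (LinearMap.mem_ker.1 y.2) ⟨v, (h v).2 hv⟩
    have h3 : ∑ w : B, A v w * y.1 w = 0 := h1
    rw [← h3]
    exact Finset.sum_congr rfl (fun w _ => by simp)⟩
  left_inv x := by
    ext v
    by_cases hv : v ∈ B
    · simp [hv]
    · simp [hv, (x.2 v hv).1]
  right_inv y := by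
    ext j
    simp

theorem finrank_KK (A : Matrix V V (ZMod 2)) (B C : Finset V) (h : ∀ v, v ∈ C ↔ v ∉ B) :
    (A.submatrix (fun i : C => (i : V)) (fun j : B => (j : V))).rank
      + Module.finrank (ZMod 2) (KK A B) = B.card := by
  rw [(kkEquiv A B C h).finrank_eq, Matrix.rank, LinearMap.finrank_range_add_finrank_ker]
  simp

theorem finrank_compl (A : Matrix V V (ZMod 2)) (hA : A.transpose = A) (B C : Finset V)
    (h : ∀ v, v ∈ C ↔ v ∉ B) :
    Module.finrank (ZMod 2) (KK A B) + C.card = Module.finrank (ZMod 2) (KK A C) + B.card := by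
  have h1 := finrank_KK A B C h
  have h2 := finrank_KK A C B (fun v => by rw [h v]; simp)
  rw [← Matrix.rank_transpose, Matrix.transpose_submatrix, hA] at h2
  omega

/-- Sum functional. -/
def sumF (V : Type) [Fintype V] : (V → ZMod 2) →ₗ[ZMod 2] ZMod 2 where
  toFun x := ∑ v, x v
  map_add' x y := by simp [Finset.sum_add_distrib]
  map_smul' c x := by simp [Finset.mul_sum]

theorem core (A : Matrix V V (ZMod 2)) (hA : A.transpose = A) (k : ℕ) (hk : 5 ≤ k)
    (hV : Fintype.card V = 2 * k - 1)
    (h1 : ∀ B : Finset V, B.card = k → ∃ x ∈ KK A B, sumF V x ≠ 0)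
    (h2 : ∀ B : Finset V, B.card = k - 1 → ∀ x ∈ KK A B, sumF V x = 0) : False := by
  have key : ∀ T T' : Finset V, T.card = k - 1 → T'.card = k - 1 → Disjoint T T' →
      ∃ B, T ⊆ B ∧ (∀ v, v ∈ B ↔ v ∉ T') ∧ KK A T ≤ KK A B ⊓ LinearMap.ker (sumF V) ∧
      Module.finrank (ZMod 2) ↥(KK A B ⊓ LinearMap.ker (sumF V))
        ≤ Module.finrank (ZMod 2) (KK A T') := by
    intro T T' hT hT' hd
    have hsub : T ⊆ T'ᶜ := by
      intro v hv
      rw [Finset.mem_compl]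
      exact Finset.disjoint_left.1 hd hv
    have hc : (T'ᶜ).card = k := by rw [Finset.card_compl]; omega
    refine ⟨T'ᶜ, hsub, by simp, ?_, ?_⟩
    · exact le_inf (KK_mono A hsub) (fun x hx => LinearMap.mem_ker.2 (h2 T hT x hx))
    · obtain ⟨x, hx, hs⟩ := h1 _ hc
      have hlt : KK A T'ᶜ ⊓ LinearMap.ker (sumF V) < KK A T'ᶜ := by
        refine lt_of_le_of_ne inf_le_left ?_
        intro he
        rw [← he] at hx
        exact hs (LinearMap.mem_ker.1 hx.2)
      have h3 := Submodule.finrank_lt_finrank_of_lt hlt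
      have h4 := finrank_compl A hA T'ᶜ T' (by simp)
      omega
  have pure : ∀ B : Finset V, B.card = k → ∀ x ∈ KK A B, sumF V x = 0 → x = 0 := by
    intro B hB x hx hs
    ext v
    by_cases hv : v ∈ B
    · have hT : (B.erase v).card = k - 1 := by rw [Finset.card_erase_of_mem hv, hB]
      have hT' : (Bᶜ).card = k - 1 := by rw [Finset.card_compl]; omega
      have hd : Disjoint (B.erase v) Bᶜ := by
        rw [Finset.disjoint_left]
        intro w hw
        simp [Finset.mem_of_mem_erase hw]
      obtain ⟨B1, _, hB1, hle, hf⟩ := key _ _ hT hT' hd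
      obtain ⟨B2, _, _, hle2, hf2⟩ := key _ _ hT' hT hd.symm
      have e : B1 = B := by
        ext w
        simp [hB1 w]
      subst e
      have h5 := Submodule.finrank_mono hle2
      have h6 := Submodule.eq_of_le_of_finrank_le hle (hf.trans (h5.trans hf2))
      have hx' : x ∈ KK A (B1.erase v) := by
        rw [h6]
        exact ⟨hx, LinearMap.mem_ker.2 hs⟩
      exact (hx' v (by simp)).1
    · exact (hx v hv).1
  obtain ⟨B', -, hB'⟩ := Finset.exists_subset_card_eq
    (s := (Finset.univ : Finset V)) (n := k + 1) (by rw [Finset.card_univ]; omega)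
  obtain ⟨u, hu⟩ : B'.Nonempty := Finset.card_pos.1 (by omega)
  have hex : ∀ i : V, ∃ x : V → ZMod 2, i ∈ B' → x ∈ KK A (B'.erase i) ∧ sumF V x ≠ 0 := by
    intro i
    by_cases hi : i ∈ B'
    · obtain ⟨x, hx⟩ := h1 (B'.erase i) (by rw [Finset.card_erase_of_mem hi]; omega)
      exact ⟨x, fun _ => hx⟩
    · exact ⟨0, fun h => absurd h hi⟩
  choose f hf using hex
  obtain ⟨i, hi, j, hj, hij, he⟩ := Finset.exists_ne_map_eq_of_card_lt_of_maps_to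
    (s := B'.erase u) (t := (Finset.univ : Finset (ZMod 2 × ZMod 2)))
    (f := fun i => (f i u, (A.mulVec (f i)) u))
    (by
      rw [Finset.card_erase_of_mem hu, Finset.card_univ, Fintype.card_prod, ZMod.card]
      omega) (fun _ _ => Finset.mem_coe.2 (Finset.mem_univ _))
  have hi' := Finset.mem_of_mem_erase hi
  have hj' := Finset.mem_of_mem_erase hj
  obtain ⟨hi1, hi2⟩ := hf i hi'
  obtain ⟨hj1, hj2⟩ := hf j hj'
  have two : ∀ a b : ZMod 2, a ≠ 0 → b ≠ 0 → a - b = 0 := by decide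
  simp only [Prod.mk.injEq] at he
  have hz : f i - f j = 0 := by
    apply pure (B'.erase u) (by rw [Finset.card_erase_of_mem hu]; omega)
    · intro v hv
      rw [Matrix.mulVec_sub, Pi.sub_apply, Pi.sub_apply]
      by_cases hvu : v = u
      · subst hvu
        rw [he.1, he.2]
        simp
      · have hvB : v ∉ B' := fun h => hv (Finset.mem_erase.2 ⟨hvu, h⟩)
        have a1 := hi1 v (fun h => hvB (Finset.mem_of_mem_erase h))
        have a2 := hj1 v (fun h => hvB (Finset.mem_of_mem_erase h))
        simp [a1.1, a1.2, a2.1, a2.2]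
    · rw [map_sub]
      exact two _ _ hi2 hj2
  have hfe : f i = f j := sub_eq_zero.1 hz
  refine hi2 (h2 ((B'.erase i).erase j) ?_ (f i) ?_)
  · rw [Finset.card_erase_of_mem (Finset.mem_erase.2 ⟨hij.symm, hj'⟩),
      Finset.card_erase_of_mem hi']
    omega
  · intro v hv
    by_cases hvj : v = j
    · rw [hfe]
      exact hj1 v (by simp [hvj])
    · exact hi1 v (fun h => hv (Finset.mem_erase.2 ⟨hvj, h⟩))

theorem mulVec_ind (G : SimpleGraph V) [DecidableRel G.Adj] (D : Finset V) (v : V) :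
    ((G.adjMatrix (ZMod 2)).mulVec (fun w => if w ∈ D then 1 else 0)) v
      = (((G.neighborFinset v) ∩ D).card : ZMod 2) := by
  rw [SimpleGraph.adjMatrix_mulVec_apply]
  simp [Finset.sum_ite_mem]

theorem accessing_iff (G : SimpleGraph V) [DecidableRel G.Adj] (B : Finset V) :
    accessing G B ↔ ∃ x ∈ KK (G.adjMatrix (ZMod 2)) B, sumF V x ≠ 0 := by
  have main : ∀ D : Finset V, (D ⊆ B ∧ Odd D.card ∧ oddNbhd G D ⊆ B) ↔
      ((fun w => if w ∈ D then (1 : ZMod 2) else 0) ∈ KK (G.adjMatrix (ZMod 2)) B ∧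
        sumF V (fun w => if w ∈ D then (1 : ZMod 2) else 0) ≠ 0) := by
    intro D
    have hs : sumF V (fun w => if w ∈ D then (1 : ZMod 2) else 0) = (D.card : ZMod 2) := by
      simp [sumF]
    rw [hs, ZMod.natCast_ne_zero_iff_odd, mem_KK]
    have ho : (∀ v, v ∉ B → (if v ∈ D then (1 : ZMod 2) else 0) = 0 ∧
        ((G.adjMatrix (ZMod 2)).mulVec (fun w => if w ∈ D then 1 else 0)) v = 0) ↔
        (D ⊆ B ∧ oddNbhd G D ⊆ B) := by
      simp only [mulVec_ind, ZMod.natCast_eq_zero_iff_even]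
      constructor
      · intro h
        constructor
        · intro v hv
          by_contra hb
          have := (h v hb).1
          simp [hv] at this
        · intro v hv
          by_contra hb
          have := (h v hb).2
          simp only [oddNbhd, Finset.mem_filter] at hv
          exact (Nat.not_odd_iff_even.2 this) hv.2
      · rintro ⟨ha, hb⟩ v hv
        refine ⟨if_neg (fun h => hv (ha h)), ?_⟩
        rw [← Nat.not_odd_iff_even]
        intro h
        exact hv (hb (by simp only [oddNbhd, Finset.mem_filter]; exact ⟨Finset.mem_univ _, h⟩))
    rw [ho]
    tauto
  constructor
  · rintro ⟨D, h⟩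
    exact ⟨_, (main D).1 h⟩
  · rintro ⟨x, hx⟩
    have hx2 : x = (fun w => if w ∈ (Finset.univ.filter fun w => x w ≠ 0)
        then (1 : ZMod 2) else 0) := by
      have two : ∀ a : ZMod 2, a = if a ≠ 0 then 1 else 0 := by decide
      ext w
      simp only [Finset.mem_filter, Finset.mem_univ, true_and]
      exact two (x w)
    rw [hx2] at hx
    exact ⟨_, (main _).2 hx⟩

end helpers

/-- For all large enough numbers of players, no graph on `n = 2k − 1` vertices
combinatorially realizes a `((k, 2k−1))` threshold scheme. -/
theorem no_large_qQSS_threshold :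
    ∃ n0 : ℕ, ∀ k : ℕ, n0 ≤ 2 * k - 1 →
      ∀ (V : Type) [Fintype V] [DecidableEq V]
        (G : SimpleGraph V) [DecidableRel G.Adj],
        Fintype.card V = 2 * k - 1 → ¬ realizesThreshold G k := by
  refine ⟨9, ?_⟩
  intro k hk V _ _ G _ hV h
  refine core (G.adjMatrix (ZMod 2)) (SimpleGraph.transpose_adjMatrix _) k (by omega) hV ?_ ?_
  · intro B hB
    exact (accessing_iff G B).1 (h.1 B hB).1
  · intro B hB x hx
    by_contra hs
    exact h.2 B (by omega) ((accessing_iff G B).2 ⟨x, hx, hs⟩)
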